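/- (Pogorelov's estimate.) For every n ≥ 2 and positive constants K₀, K₁ there exists a constant C > 0, depending only on n, K₀, K₁, with the following property. Let Ω ⊂ ℝⁿ be a bounded open convex set, let ψ ∈ C⁴(Ω) ∩ C⁰(Ω̄) be convex with ψ = 0 on ∂Ω, and let h : Ω × ℝ × ℝⁿ → (0,∞) be a C² function such that det D²ψ(x) = h(x, ψ(x), Dψ(x)) for all x ∈ Ω. Assume sup_Ω (|ψ| + |Dψ|) ≤ K₀ and that the C² norm of log h (over Ω × [−K₀, K₀] × B̄_{K₀}) is at most K₁. Then (−ψ(x))·‖D²ψ(x)‖ ≤ C for all x ∈ Ω. -/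

import Mathlib

open MeasureTheory
open scoped ENNReal

noncomputable section

/-- Euclidean n-space. -/
abbrev Eu (n : ℕ) := EuclideanSpace ℝ (Fin n)

/-- Partial derivative ∂ψ/∂xᵢ. -/
def pd {n : ℕ} (ψ : Eu n → ℝ) (i : Fin n) (x : Eu n) : ℝ :=
  fderiv ℝ ψ x (EuclideanSpace.single i 1)

/-- Second partial derivative ∂²ψ/∂xᵢ∂xⱼ. -/
def pd2 {n : ℕ} (ψ : Eu n → ℝ) (i j : Fin n) (x : Eu n) : ℝ :=
  pd (pd ψ j) i x


/-- The derivative of `f` in the direction `v`, as a function of the base point. -/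
def dirDeriv {E : Type*} [NormedAddCommGroup E] [NormedSpace ℝ E] (v : E) (f : E → ℝ) : E → ℝ :=
  fun x => fderiv ℝ f x v

section DirDeriv

variable {E : Type*} [NormedAddCommGroup E] [NormedSpace ℝ E] {Ω : Set E} {f g : E → ℝ}

lemma ContDiffOn.dirDeriv {m k : WithTop ℕ∞} (hf : ContDiffOn ℝ k f Ω) (hΩ : IsOpen Ω)
    (hmk : m + 1 ≤ k) (v : E) : ContDiffOn ℝ m (dirDeriv v f) Ω :=
  (hf.fderiv_of_isOpen hΩ hmk).clm_apply contDiffOn_const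

lemma ContDiffOn.differentiableAt_of_isOpen {k : WithTop ℕ∞} (hf : ContDiffOn ℝ k f Ω)
    (hΩ : IsOpen Ω) (hk : k ≠ 0) {x : E} (hx : x ∈ Ω) : DifferentiableAt ℝ f x :=
  (hf.contDiffAt (hΩ.mem_nhds hx)).differentiableAt hk

lemma hasDerivAt_along_line {x v : E} {t : ℝ} (hf : DifferentiableAt ℝ f (x + t • v)) :
    HasDerivAt (fun s : ℝ => f (x + s • v)) (dirDeriv v f (x + t • v)) t := by
  have h1 : HasDerivAt (fun s : ℝ => x + s • v) v t := by
    simpa using ((hasDerivAt_id t).smul_const v).const_add x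
  exact hf.hasFDerivAt.comp_hasDerivAt t h1

lemma dirDeriv_dirDeriv {x : E} (hf : ContDiffAt ℝ 2 f x) (v w : E) :
    dirDeriv v (dirDeriv w f) x = fderiv ℝ (fderiv ℝ f) x v w := by
  have h : DifferentiableAt ℝ (fderiv ℝ f) x :=
    (hf.fderiv_right (m := 1) (by norm_num)).differentiableAt (by norm_num)
  have h2 : HasFDerivAt (fun y => fderiv ℝ f y w) _ x :=
    h.hasFDerivAt.clm_apply (hasFDerivAt_const w x)
  change fderiv ℝ (fun y => fderiv ℝ f y w) x v = _
  rw [h2.fderiv]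
  simp

lemma dirDeriv_comm {x : E} (hf : ContDiffAt ℝ 2 f x) (v w : E) :
    dirDeriv v (dirDeriv w f) x = dirDeriv w (dirDeriv v f) x := by
  rw [dirDeriv_dirDeriv hf, dirDeriv_dirDeriv hf]
  exact (hf.isSymmSndFDerivAt (by simp)).eq v w

lemma dirDeriv_congr (hΩ : IsOpen Ω) (h : Set.EqOn f g Ω) (v : E) :
    Set.EqOn (dirDeriv v f) (dirDeriv v g) Ω := by
  intro x hx
  have : f =ᶠ[nhds x] g := h.eventuallyEq_of_mem (hΩ.mem_nhds hx)
  simp only [dirDeriv, this.fderiv_eq]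

lemma eventually_line_mem (hΩ : IsOpen Ω) {x : E} (hx : x ∈ Ω) (v : E) :
    ∀ᶠ t : ℝ in nhds 0, x + t • v ∈ Ω := by
  have h : ContinuousAt (fun t : ℝ => x + t • v) 0 := by fun_prop
  exact h.eventually (hΩ.mem_nhds (by simpa using hx))

end DirDeriv

section SecondOrder

lemma IsLocalMax.second_deriv_nonpos {f f' : ℝ → ℝ} {f'' x : ℝ} (hmax : IsLocalMax f x)
    (hf : ∀ᶠ t in nhds x, HasDerivAt f (f' t) t) (hf' : HasDerivAt f' f'' x) :
    f' x = 0 ∧ f'' ≤ 0 := by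
  have hd : deriv f =ᶠ[nhds x] f' := hf.mono fun t ht => ht.deriv
  have hdd : deriv (deriv f) x = f'' := by rw [hd.deriv_eq, hf'.deriv]
  have h0 : deriv f x = 0 := hmax.deriv_eq_zero
  refine ⟨by rw [← hd.self_of_nhds, h0], ?_⟩
  by_contra! hpos
  have hmin : IsLocalMin f x :=
    isLocalMin_of_deriv_deriv_pos (by rw [hdd]; exact hpos) h0
      hf.self_of_nhds.continuousAt
  have hconst : f =ᶠ[nhds x] fun _ => f x := by
    filter_upwards [hmin, hmax] with t h1 h2 using le_antisymm h2 h1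
  have : deriv f =ᶠ[nhds x] fun _ => 0 := by
    filter_upwards [hconst.eventuallyEq_nhds] with t ht
    rw [ht.deriv_eq, deriv_const]
  rw [this.deriv_eq, deriv_const] at hdd
  exact hpos.ne hdd

lemma HasFDerivAt.second_deriv_comp {F : Type*} [NormedAddCommGroup F] [NormedSpace ℝ F]
    {g : F → ℝ} {γ γ' : ℝ → F} {γ'' : F} {x : ℝ} (hg : ContDiffAt ℝ 2 g (γ x))
    (hγ : ∀ᶠ t in nhds x, HasDerivAt γ (γ' t) t) (hγ' : HasDerivAt γ' γ'' x) :
    (∀ᶠ t in nhds x, HasDerivAt (fun s => g (γ s)) (fderiv ℝ g (γ t) (γ' t)) t) ∧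
    HasDerivAt (fun t => fderiv ℝ g (γ t) (γ' t))
      (fderiv ℝ (fderiv ℝ g) (γ x) (γ' x) (γ' x) + fderiv ℝ g (γ x) γ'') x := by
  have h1 : ∀ᶠ z in nhds (γ x), DifferentiableAt ℝ g z :=
    (hg.eventually (by simp)).mono fun z hz => hz.differentiableAt (by norm_num)
  have h2 : DifferentiableAt ℝ (fderiv ℝ g) (γ x) :=
    (hg.fderiv_right (m := 1) (by norm_num)).differentiableAt (by norm_num)
  constructor
  · filter_upwards [hγ.self_of_nhds.continuousAt.eventually h1, hγ] with t ht hγt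
    exact ht.hasFDerivAt.comp_hasDerivAt t hγt
  · exact (h2.hasFDerivAt.comp_hasDerivAt x hγ.self_of_nhds).clm_apply hγ'

end SecondOrder

section LogDet

variable {n : ℕ}

lemma hasDerivAt_det {A : ℝ → Matrix (Fin n) (Fin n) ℝ} {A' : Matrix (Fin n) (Fin n) ℝ} {t : ℝ}
    (hA : ∀ i j, HasDerivAt (fun s => A s i j) (A' i j) t) :
    HasDerivAt (fun s => (A s).det) (∑ i, ∑ j, (A t).adjugate j i * A' i j) t := by
  let D : ContinuousMultilinearMap ℝ (fun _ : Fin n => Fin n → ℝ) ℝ :=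
    { Matrix.detRowAlternating.toMultilinearMap with
      cont := Continuous.matrix_det (A := fun M : Matrix (Fin n) (Fin n) ℝ => M) continuous_id }
  have h1 : HasDerivAt (fun s => (A s : Fin n → Fin n → ℝ)) A' t :=
    hasDerivAt_pi.2 fun i => hasDerivAt_pi.2 fun j => hA i j
  have h2 := (D.hasFDerivAt (A t)).comp_hasDerivAt t h1
  refine h2.congr_deriv ?_
  refine (ContinuousMultilinearMap.linearDeriv_apply D (A t) A').trans ?_
  symm
  refine Finset.sum_congr rfl fun i _ => ?_
  have h3 : D (Function.update (A t) i (A' i)) = ((A t).updateRow i (A' i)).det := rfl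
  rw [h3]
  simp only [Matrix.adjugate_apply]
  have h4 := (Matrix.detRowAlternating.toMultilinearMap.toLinearMap (A t) i).pi_apply_eq_sum_univ
    (A' i)
  calc ∑ j, ((A t).updateRow i (Pi.single j 1)).det * A' i j
      = ∑ j, A' i j • ((A t).updateRow i (Pi.single j 1)).det := by
        simp only [smul_eq_mul, mul_comm]
    _ = _ := by
        refine Eq.trans (Finset.sum_congr rfl fun j _ => ?_) h4.symm
        have h5 : (Pi.single j 1 : Fin n → ℝ) = fun k => if j = k then 1 else 0 := by
          ext k
          simp [Pi.single_apply, eq_comm]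
        rw [h5]
        rfl

/-- First and second derivatives of `log det` along a curve of matrices that is diagonal with
positive entries at the base point. -/
lemma hasDerivAt_log_det {A A' : ℝ → Matrix (Fin n) (Fin n) ℝ} {A'' : Matrix (Fin n) (Fin n) ℝ}
    {l : Fin n → ℝ} (hl : ∀ i, 0 < l i) (hA0 : A 0 = Matrix.diagonal l)
    (hA : ∀ᶠ t in nhds 0, ∀ i j, HasDerivAt (fun s => A s i j) (A' t i j) t)
    (hA' : ∀ i j, HasDerivAt (fun s => A' s i j) (A'' i j) 0) :
    ∃ φ : ℝ → ℝ, (∀ᶠ t in nhds 0, HasDerivAt (fun s => Real.log (A s).det) (φ t) t) ∧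
      φ 0 = ∑ i, A' 0 i i / l i ∧
      HasDerivAt φ (∑ i, A'' i i / l i - ∑ i, ∑ j, A' 0 i j * A' 0 j i / (l i * l j)) 0 := by
  have hdet0 : (A 0).det ≠ 0 := by
    rw [hA0, Matrix.det_diagonal]
    exact (Finset.prod_pos fun i _ => hl i).ne'
  have hdet : ∀ᶠ t in nhds 0, HasDerivAt (fun s => (A s).det)
      (∑ i, ∑ j, (A t).adjugate j i * A' t i j) t := hA.mono fun t ht => hasDerivAt_det ht
  have hne : ∀ᶠ t in nhds 0, (A t).det ≠ 0 :=
    hdet.self_of_nhds.continuousAt.eventually_ne hdet0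
  have hinv0 : ∀ i j, (A 0)⁻¹ i j = if i = j then (l i)⁻¹ else 0 := by
    intro i j
    have : (A 0)⁻¹ = Matrix.diagonal (fun i => (l i)⁻¹) := by
      apply Matrix.inv_eq_left_inv
      rw [hA0, Matrix.diagonal_mul_diagonal, ← Matrix.diagonal_one]
      congr 1
      ext i
      exact inv_mul_cancel₀ (hl i).ne'
    rw [this, Matrix.diagonal_apply]
  have hinv_diff : ∀ i j, DifferentiableAt ℝ (fun s => (A s)⁻¹ i j) 0 := by
    intro i j
    have h1 : DifferentiableAt ℝ (fun s => (A s).adjugate i j) 0 := by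
      simp only [Matrix.adjugate_apply]
      refine (hasDerivAt_det (A' := Matrix.updateRow (A' 0) j 0) fun a b => ?_).differentiableAt
      by_cases h : a = j
      · subst h
        simpa using hasDerivAt_const _ _
      · simpa [Matrix.updateRow_ne h] using hA.self_of_nhds a b
    have h2 : (fun s => (A s)⁻¹ i j) = fun s => ((A s).det)⁻¹ * (A s).adjugate i j := by
      ext s
      rw [Matrix.inv_def, Ring.inverse_eq_inv', Matrix.smul_apply, smul_eq_mul]
    rw [h2]
    exact (hdet.self_of_nhds.differentiableAt.inv hdet0).mul h1
  have hinv : ∀ i j, HasDerivAt (fun s => (A s)⁻¹ i j) (-(A' 0 i j / (l i * l j))) 0 := by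
    intro i j
    have h1 := (hinv_diff i j).hasDerivAt
    have h2 : HasDerivAt (fun s => ∑ k, A s i k * (A s)⁻¹ k j)
        (∑ k, (A' 0 i k * (A 0)⁻¹ k j + A 0 i k * deriv (fun s => (A s)⁻¹ k j) 0)) 0 :=
      HasDerivAt.fun_sum fun k _ => (hA.self_of_nhds i k).mul (hinv_diff k j).hasDerivAt
    have h3 : (fun s => ∑ k, A s i k * (A s)⁻¹ k j) =ᶠ[nhds 0]
        fun _ => (1 : Matrix (Fin n) (Fin n) ℝ) i j := by
      filter_upwards [hne] with t ht
      rw [← Matrix.mul_apply, Matrix.mul_nonsing_inv _ (isUnit_iff_ne_zero.2 ht)]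
    have h4 := h2.unique ((hasDerivAt_const _ _).congr_of_eventuallyEq h3)
    have hi := (hl i).ne'
    have hj := (hl j).ne'
    have h5 : deriv (fun s => (A s)⁻¹ i j) 0 = -(A' 0 i j / (l i * l j)) := by
      simp only [hinv0] at h4
      simp only [hA0, Matrix.diagonal_apply, Finset.sum_add_distrib, mul_ite, ite_mul,
        zero_mul, mul_zero, Finset.sum_ite_eq, Finset.sum_ite_eq', Finset.mem_univ, if_true] at h4
      field_simp
      field_simp at h4
      linarith
    rwa [h5] at h1
  refine ⟨fun t => ∑ i, ∑ j, (A t)⁻¹ j i * A' t i j, ?_, ?_, ?_⟩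
  · filter_upwards [hdet, hne] with t h1 h2
    convert h1.log h2 using 1
    simp only [Matrix.inv_def, Ring.inverse_eq_inv', Matrix.smul_apply, smul_eq_mul,
      Finset.sum_div]
    refine Finset.sum_congr rfl fun i _ => Finset.sum_congr rfl fun j _ => ?_
    field_simp
  · simp only [hinv0, ite_mul, zero_mul, Finset.sum_ite_eq', Finset.mem_univ, if_true]
    refine Finset.sum_congr rfl fun i _ => ?_
    rw [div_eq_inv_mul]
  · have h : HasDerivAt (fun t => ∑ i, ∑ j, (A t)⁻¹ j i * A' t i j)
        (∑ i, ∑ j, (-(A' 0 j i / (l j * l i)) * A' 0 i j + (A 0)⁻¹ j i * A'' i j)) 0 :=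
      HasDerivAt.fun_sum fun i _ => HasDerivAt.fun_sum fun j _ => (hinv j i).mul (hA' i j)
    convert h using 1
    simp only [hinv0, ite_mul, zero_mul, Finset.sum_add_distrib, Finset.sum_ite_eq',
      Finset.mem_univ, if_true]
    rw [add_comm, sub_eq_add_neg, ← Finset.sum_neg_distrib]
    congr 1
    · refine Finset.sum_congr rfl fun i _ => ?_
      rw [div_eq_inv_mul]
    · refine Finset.sum_congr rfl fun i _ => ?_
      rw [← Finset.sum_neg_distrib]
      refine Finset.sum_congr rfl fun j _ => ?_
      rw [mul_comm (l j)]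
      ring

end LogDet

section MaximumPointInequality

variable {n : ℕ}

/-- Discarding terms in the quadratic third-order expression of the twice differentiated
Monge–Ampère equation. -/
lemma sum_third_order_ge {o : Fin n} {l : Fin n → ℝ} {T : Fin n → Fin n → ℝ} (hl : ∀ i, 0 < l i)
    (hT : ∀ i j, T i j = T j i) :
    ∑ i, T o i ^ 2 / (l i * l o) + ∑ i ∈ Finset.univ.erase o, T o i ^ 2 / (l i * l o) ≤
      ∑ i, ∑ j, T i j * T j i / (l i * l j) := by
  have hnn : ∀ i j, 0 ≤ T i j * T j i / (l i * l j) := fun i j => by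
    rw [hT j i]
    exact div_nonneg (mul_self_nonneg _) (mul_pos (hl i) (hl j)).le
  rw [← Finset.add_sum_erase Finset.univ (fun i => ∑ j, T i j * T j i / (l i * l j))
    (Finset.mem_univ o)]
  refine add_le_add (Finset.sum_le_sum fun i _ => ?_) (Finset.sum_le_sum fun i _ => ?_)
  · rw [hT i o, sq, mul_comm (l i)]
  · refine le_trans ?_ (Finset.single_le_sum (fun j _ => hnn i j) (Finset.mem_univ o))
    rw [hT i o, sq]

/-- The weight of the gradient term in Pogorelov's auxiliary function. -/
def pogorelovWeight (K₀ K₁ : ℝ) : ℝ := K₁ * ((2 + K₀) ^ 2 + 1) + 1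

/-- The bound for Pogorelov's auxiliary function at a maximum point, without its gradient
factor. -/
def pogorelovBound (n : ℕ) (K₀ K₁ : ℝ) : ℝ :=
  n + 2 * pogorelovWeight K₀ K₁ * n * K₀ ^ 2 + n * (K₀ * K₁) + K₀ ^ 2 +
    pogorelovWeight K₀ K₁ * n * (K₀ * (K₁ * (1 + K₀))) * K₀ + 1 + K₀

lemma pogorelovWeight_pos {K₀ K₁ : ℝ} (hK₁ : 0 < K₁) :
    0 < pogorelovWeight K₀ K₁ := by
  unfold pogorelovWeight; positivity

lemma le_pogorelovBound_of_maximum {K₀ K₁ w : ℝ} (hK₀ : 0 < K₀) (hK₁ : 0 < K₁)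
    (o : Fin n) {l p S q c : Fin n → ℝ} {T R : Fin n → Fin n → ℝ}
    (hl : ∀ i, 0 < l i) (hT : ∀ i j, T i j = T j i) (hw : w < 0) (hwK : -w ≤ K₀)
    (hp : ∀ i, |p i| ≤ K₀) (hq : ∀ i, |q i| ≤ K₁) (hc : ∀ i, |c i| ≤ K₁ * (1 + K₀))
    (h_first : ∀ i, p i / w + T o i / l o + pogorelovWeight K₀ K₁ * (p i * l i) = 0)
    (h_second : ∀ i, l i / w - (p i / w) ^ 2 + (S i / l o - (T o i / l o) ^ 2) +
      pogorelovWeight K₀ K₁ * (l i ^ 2 + ∑ k, p k * R k i) ≤ 0)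
    (h_eq : ∀ k, ∑ i, R k i / l i = c k + l k * q k)
    (h_eq_second : -(K₁ * (1 + K₀ + l o) ^ 2) - K₁ * l o + ∑ k, q k * T o k ≤
      ∑ i, S i / l i - ∑ i, ∑ j, T i j * T j i / (l i * l j)) :
    -w * l o ≤ pogorelovBound n K₀ K₁ := by
  have hβ := pogorelovWeight_pos (K₀ := K₀) hK₁
  set β := pogorelovWeight K₀ K₁ with hβdef
  have hlo := hl o
  have hp2 : ∀ i, p i ^ 2 ≤ K₀ ^ 2 := fun i => sq_le_sq' (neg_le_of_abs_le (hp i))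
    (le_of_abs_le (hp i))
  have hb : 0 ≤ 2 * β * n * K₀ ^ 2 ∧ 0 ≤ n * (K₀ * K₁) ∧
      0 ≤ β * n * (K₀ * (K₁ * (1 + K₀))) := by
    refine ⟨?_, ?_, ?_⟩ <;> positivity
  unfold pogorelovBound
  rw [← hβdef]
  by_cases hlo1 : l o < 1
  · have : -w * l o ≤ K₀ := by nlinarith
    linarith [sq_nonneg K₀, (Nat.cast_nonneg n : (0:ℝ) ≤ n), mul_nonneg hb.2.2 hK₀.le]
  push Not at hlo1
  have h1 : ∑ i, (1 / w - (p i / w) ^ 2 / l i + S i / l i / l o - T o i ^ 2 / (l i * l o) / l o +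
      β * (l i + ∑ k, p k * (R k i / l i))) ≤ 0 := by
    refine Finset.sum_nonpos fun i _ => ?_
    have h := div_nonpos_of_nonpos_of_nonneg (h_second i) (hl i).le
    refine le_of_eq_of_le ?_ h
    have hli := (hl i).ne'
    have hs : ∑ k, p k * (R k i / l i) = (∑ k, p k * R k i) / l i := by
      rw [Finset.sum_div]
      exact Finset.sum_congr rfl fun k _ => by ring
    have hw' := hw.ne
    rw [hs]
    field_simp
    ring
  have hswap : ∑ i, ∑ k, p k * (R k i / l i) = ∑ k, p k * (c k + l k * q k) := by
    rw [Finset.sum_comm]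
    refine Finset.sum_congr rfl fun k _ => ?_
    rw [← Finset.mul_sum, h_eq]
  simp only [Finset.sum_add_distrib, Finset.sum_sub_distrib, ← Finset.mul_sum, ← Finset.sum_div,
    hswap, Finset.sum_const, Finset.card_univ, Fintype.card_fin, nsmul_eq_mul] at h1
  have h2 := sum_third_order_ge (o := o) hl hT
  have h3 : ∑ k, q k * T o k / l o = -(∑ k, q k * p k / w) - β * ∑ k, p k * (l k * q k) := by
    rw [Finset.mul_sum, ← Finset.sum_neg_distrib, ← Finset.sum_sub_distrib]
    refine Finset.sum_congr rfl fun k _ => ?_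
    have := h_first k
    have h4 : T o k / l o = -(p k / w) - β * (p k * l k) := by linarith
    rw [mul_div_assoc, h4]
    ring
  have h4 : ∑ i, (p i / w) ^ 2 / l i - ∑ i ∈ Finset.univ.erase o, T o i ^ 2 / (l i * l o) / l o ≤
      (p o / w) ^ 2 / l o + n * (2 * β * K₀ ^ 2 / -w) := by
    rw [← Finset.add_sum_erase Finset.univ _ (Finset.mem_univ o), add_sub_assoc,
      ← Finset.sum_sub_distrib]
    gcongr
    have hnn : 0 ≤ 2 * β * K₀ ^ 2 / -w := div_nonneg (by positivity) (by linarith)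
    refine (Finset.sum_le_card_nsmul _ _ (2 * β * K₀ ^ 2 / -w) fun i _ => ?_).trans ?_
    · have hli := (hl i).ne'
      have h5 : T o i ^ 2 / (l i * l o) / l o = (p i / w + β * (p i * l i)) ^ 2 / l i := by
        have : T o i / l o = -(p i / w + β * (p i * l i)) := by linarith [h_first i]
        have e : T o i ^ 2 / (l i * l o) / l o = (T o i / l o) ^ 2 / l i := by field_simp
        rw [e, this, neg_sq]
      have hw' := hw.ne
      have h6 : (p i / w) ^ 2 / l i - (p i / w + β * (p i * l i)) ^ 2 / l i =
          2 * β * p i ^ 2 / -w - β ^ 2 * p i ^ 2 * l i := by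
        field_simp
        ring
      rw [h5, h6]
      have h8 : 2 * β * p i ^ 2 / -w ≤ 2 * β * K₀ ^ 2 / -w :=
        div_le_div_of_nonneg_right (mul_le_mul_of_nonneg_left (hp2 i) (by positivity))
          (by linarith)
      have h9 : 0 ≤ β ^ 2 * p i ^ 2 * l i := mul_nonneg (by positivity) (hl i).le
      linarith
    · rw [nsmul_eq_mul]
      gcongr
      exact (Finset.card_le_univ _).trans (by simp)
  have h5 : ∑ k, q k * p k / w ≤ n * (K₀ * K₁ / -w) := by
    refine (Finset.sum_le_card_nsmul _ _ (K₀ * K₁ / -w) fun k _ => ?_).trans (by simp)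
    rw [← neg_div_neg_eq]
    refine div_le_div_of_nonneg_right ?_ (by linarith)
    refine (neg_le_abs _).trans ?_
    rw [abs_mul, mul_comm K₀]
    exact mul_le_mul (hq k) (hp k) (abs_nonneg _) hK₁.le
  have h6 : -(n * (K₀ * (K₁ * (1 + K₀)))) ≤ ∑ k, p k * c k := by
    have : ∑ k, -(p k * c k) ≤ n * (K₀ * (K₁ * (1 + K₀))) := by
      refine (Finset.sum_le_card_nsmul _ _ (K₀ * (K₁ * (1 + K₀))) fun k _ => ?_).trans (by simp)
      refine (neg_le_abs _).trans ?_
      rw [abs_mul]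
      exact mul_le_mul (hp k) (hc k) (abs_nonneg _) hK₀.le
    rw [Finset.sum_neg_distrib] at this
    linarith
  have h7 : l o ≤ ∑ i, l i := Finset.single_le_sum (fun i _ => (hl i).le) (Finset.mem_univ o)
  have h8 : (p o / w) ^ 2 / l o ≤ K₀ ^ 2 / (w ^ 2 * l o) := by
    rw [div_pow, div_div]
    exact div_le_div_of_nonneg_right (hp2 o) (by positivity)
  have h9 : (K₁ * (1 + K₀ + l o) ^ 2 + K₁ * l o) / l o ≤ (β - 1) * l o := by
    rw [div_le_iff₀ hlo, hβdef, pogorelovWeight]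
    have ha : (1 + K₀ + l o) ^ 2 ≤ ((2 + K₀) * l o) ^ 2 := by
      gcongr
      nlinarith
    have hb' := mul_le_mul_of_nonneg_left ha hK₁.le
    have hc' : 0 ≤ K₁ * (l o * (l o - 1)) :=
      mul_nonneg hK₁.le (mul_nonneg hlo.le (by linarith))
    linarith
  have h10 : (-(K₁ * (1 + K₀ + l o) ^ 2) - K₁ * l o + ∑ k, q k * T o k +
      (∑ i, T o i ^ 2 / (l i * l o) + ∑ i ∈ Finset.univ.erase o, T o i ^ 2 / (l i * l o))) / l o ≤
      (∑ i, S i / l i) / l o := by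
    gcongr
    linarith
  have h11 : (-(K₁ * (1 + K₀ + l o) ^ 2) - K₁ * l o + ∑ k, q k * T o k +
      (∑ i, T o i ^ 2 / (l i * l o) + ∑ i ∈ Finset.univ.erase o, T o i ^ 2 / (l i * l o))) / l o =
      -((K₁ * (1 + K₀ + l o) ^ 2 + K₁ * l o) / l o) + (∑ k, q k * T o k) / l o +
      (∑ i, T o i ^ 2 / (l i * l o)) / l o +
      (∑ i ∈ Finset.univ.erase o, T o i ^ 2 / (l i * l o)) / l o := by
    ring
  rw [h11] at h10
  rw [← Finset.sum_div, ← Finset.sum_div] at h3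
  rw [← Finset.sum_div] at h4 h5
  have h12 : ∑ k, p k * (c k + l k * q k) = ∑ k, p k * c k + ∑ k, p k * (l k * q k) := by
    rw [← Finset.sum_add_distrib]
    exact Finset.sum_congr rfl fun k _ => by ring
  rw [h12] at h1
  have h13 : β * l o ≤ β * ∑ i, l i := by gcongr
  have h14 : -(β * (n * (K₀ * (K₁ * (1 + K₀))))) ≤ β * ∑ k, p k * c k := by
    have := mul_le_mul_of_nonneg_left h6 hβ.le
    linarith
  have key : l o ≤ (n + 2 * β * n * K₀ ^ 2 + n * (K₀ * K₁)) / -w + K₀ ^ 2 / (w ^ 2 * l o) +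
      β * n * (K₀ * (K₁ * (1 + K₀))) := by
    have e1 : (n + 2 * β * n * K₀ ^ 2 + n * (K₀ * K₁)) / -w =
        -(n * 1 / w) + n * (2 * β * K₀ ^ 2 / -w) + n * (K₀ * K₁ / -w) := by
      have hw' := hw.ne
      field_simp
      ring
    rw [e1]
    linarith
  have hm : 0 < -w := by linarith
  have key2 := mul_le_mul_of_nonneg_left key hm.le
  have e2 : -w * ((n + 2 * β * n * K₀ ^ 2 + n * (K₀ * K₁)) / -w + K₀ ^ 2 / (w ^ 2 * l o) +
      β * n * (K₀ * (K₁ * (1 + K₀)))) = (n + 2 * β * n * K₀ ^ 2 + n * (K₀ * K₁)) +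
      K₀ ^ 2 / (-w * l o) + β * n * (K₀ * (K₁ * (1 + K₀))) * -w := by
    have hw' := hw.ne
    field_simp
    ring
  rw [e2] at key2
  have e3 : β * n * (K₀ * (K₁ * (1 + K₀))) * -w ≤ β * n * (K₀ * (K₁ * (1 + K₀))) * K₀ :=
    mul_le_mul_of_nonneg_left hwK hb.2.2
  by_cases ht : -w * l o < 1
  · linarith [sq_nonneg K₀, (Nat.cast_nonneg n : (0:ℝ) ≤ n), mul_nonneg hb.2.2 hK₀.le]
  · push Not at ht
    have e4 : K₀ ^ 2 / (-w * l o) ≤ K₀ ^ 2 := div_le_self (by positivity) ht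
    linarith

end MaximumPointInequality

section Commutation

variable {E : Type*} [NormedAddCommGroup E] [NormedSpace ℝ E] {Ω : Set E} {f : E → ℝ}

lemma eventually_hasDerivAt_along_line {k : WithTop ℕ∞} (hf : ContDiffOn ℝ k f Ω) (hΩ : IsOpen Ω)
    (hk : k ≠ 0) {x : E} (hx : x ∈ Ω) (v : E) :
    ∀ᶠ t : ℝ in nhds 0,
      HasDerivAt (fun s : ℝ => f (x + s • v)) (dirDeriv v f (x + t • v)) t :=
  (eventually_line_mem hΩ hx v).mono fun _ ht =>
    hasDerivAt_along_line (hf.differentiableAt_of_isOpen hΩ hk ht)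

lemma hasDerivAt_along_line_zero {k : WithTop ℕ∞} (hf : ContDiffOn ℝ k f Ω) (hΩ : IsOpen Ω)
    (hk : k ≠ 0) {x : E} (hx : x ∈ Ω) (v : E) :
    HasDerivAt (fun s : ℝ => f (x + s • v)) (dirDeriv v f x) 0 := by
  simpa using (eventually_hasDerivAt_along_line hf hΩ hk hx v).self_of_nhds

lemma dirDeriv_comm_on {k : WithTop ℕ∞} (hf : ContDiffOn ℝ k f Ω) (hΩ : IsOpen Ω)
    (hk : 2 ≤ k) (v w : E) : Set.EqOn (dirDeriv v (dirDeriv w f)) (dirDeriv w (dirDeriv v f)) Ω :=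
  fun _ hx => dirDeriv_comm ((hf.contDiffAt (hΩ.mem_nhds hx)).of_le hk) v w

lemma dirDeriv_comm_third (hf : ContDiffOn ℝ 3 f Ω) (hΩ : IsOpen Ω) (v w : E) :
    Set.EqOn (dirDeriv v (dirDeriv w (dirDeriv w f))) (dirDeriv w (dirDeriv w (dirDeriv v f))) Ω :=
  (dirDeriv_comm_on (hf.dirDeriv (m := 2) hΩ (by norm_num) w) hΩ le_rfl v w).trans
    (dirDeriv_congr hΩ (dirDeriv_comm_on hf hΩ (by norm_num) v w) w)

lemma dirDeriv_comm_fourth (hf : ContDiffOn ℝ 4 f Ω) (hΩ : IsOpen Ω) (v w : E) :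
    Set.EqOn (dirDeriv v (dirDeriv v (dirDeriv w (dirDeriv w f))))
      (dirDeriv w (dirDeriv w (dirDeriv v (dirDeriv v f)))) Ω := by
  have hf3 := hf.dirDeriv (m := 3) hΩ (by norm_num) v
  exact (dirDeriv_congr hΩ (dirDeriv_comm_third (hf.of_le (by norm_num)) hΩ v w) v).trans
    (dirDeriv_comm_third hf3 hΩ v w)

end Commutation

section MaximumPoint

variable {n : ℕ} {Ω : Set (Eu n)} {ψ : Eu n → ℝ}

lemma gradient_eq_sum (b : OrthonormalBasis (Fin n) ℝ (Eu n)) (x : Eu n) :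
    gradient ψ x = ∑ k, dirDeriv (b k) ψ x • b k := by
  rw [← b.sum_repr' (gradient ψ x)]
  refine Finset.sum_congr rfl fun k _ => ?_
  rw [real_inner_comm, inner_gradient_left, dirDeriv]

lemma norm_gradient_sq (b : OrthonormalBasis (Fin n) ℝ (Eu n)) (x : Eu n) :
    ‖gradient ψ x‖ ^ 2 = ∑ k, dirDeriv (b k) ψ x ^ 2 := by
  rw [← b.sum_sq_norm_inner_right (gradient ψ x)]
  refine Finset.sum_congr rfl fun k _ => ?_
  rw [real_inner_comm, inner_gradient_left, dirDeriv, Real.norm_eq_abs, sq_abs]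

lemma abs_dirDeriv_le_norm_gradient (b : OrthonormalBasis (Fin n) ℝ (Eu n)) (x : Eu n)
    (k : Fin n) : |dirDeriv (b k) ψ x| ≤ ‖gradient ψ x‖ := by
  rw [dirDeriv, ← inner_gradient_left]
  simpa using abs_real_inner_le_norm (gradient ψ x) (b k)

/-- The critical point conditions for Pogorelov's auxiliary function along a line. -/
lemma auxiliary_critical_conditions (hΩ : IsOpen Ω) (hψ : ContDiffOn ℝ 4 ψ Ω)
    (b : OrthonormalBasis (Fin n) ℝ (Eu n)) {x : Eu n} (hx : x ∈ Ω) {ε β : ℝ} {o : Fin n}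
    (hw : ψ x + ε < 0) (ho : 0 < dirDeriv (b o) (dirDeriv (b o) ψ) x)
    (hmax : IsLocalMax (fun y => Real.log (-(ψ y + ε)) +
      Real.log (dirDeriv (b o) (dirDeriv (b o) ψ) y) +
      β / 2 * ∑ k, dirDeriv (b k) ψ y ^ 2) x) (v : Eu n) :
    dirDeriv v ψ x / (ψ x + ε) +
      dirDeriv v (dirDeriv (b o) (dirDeriv (b o) ψ)) x / dirDeriv (b o) (dirDeriv (b o) ψ) x +
      β * ∑ k, dirDeriv (b k) ψ x * dirDeriv v (dirDeriv (b k) ψ) x = 0 ∧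
    dirDeriv v (dirDeriv v ψ) x / (ψ x + ε) - (dirDeriv v ψ x / (ψ x + ε)) ^ 2 +
      (dirDeriv v (dirDeriv v (dirDeriv (b o) (dirDeriv (b o) ψ))) x /
        dirDeriv (b o) (dirDeriv (b o) ψ) x -
        (dirDeriv v (dirDeriv (b o) (dirDeriv (b o) ψ)) x /
        dirDeriv (b o) (dirDeriv (b o) ψ) x) ^ 2) +
      β * ∑ k, (dirDeriv v (dirDeriv (b k) ψ) x ^ 2 +
        dirDeriv (b k) ψ x * dirDeriv v (dirDeriv v (dirDeriv (b k) ψ)) x) ≤ 0 := by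
  have hψ1 : ∀ u, ContDiffOn ℝ 3 (dirDeriv u ψ) Ω := fun u => hψ.dirDeriv hΩ (by norm_num) u
  have hψ2 : ∀ u u', ContDiffOn ℝ 2 (dirDeriv u (dirDeriv u' ψ)) Ω :=
    fun u u' => (hψ1 u').dirDeriv hΩ (by norm_num) u
  have hψ3 : ∀ u u' u'', ContDiffOn ℝ 1 (dirDeriv u (dirDeriv u' (dirDeriv u'' ψ))) Ω :=
    fun u u' u'' => (hψ2 u' u'').dirDeriv hΩ (by norm_num) u
  set F := dirDeriv (b o) (dirDeriv (b o) ψ) with hF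
  have hline : ContinuousAt (fun t : ℝ => x + t • v) 0 := by fun_prop
  have hline0 : x + (0 : ℝ) • v = x := by simp
  have e0 := eventually_hasDerivAt_along_line hψ hΩ (by norm_num) hx v
  have eF := eventually_hasDerivAt_along_line (hψ2 (b o) (b o)) hΩ (by norm_num) hx v
  have ek : ∀ᶠ t : ℝ in nhds 0, ∀ k, HasDerivAt (fun s : ℝ => dirDeriv (b k) ψ (x + s • v))
      (dirDeriv v (dirDeriv (b k) ψ) (x + t • v)) t :=
    Filter.eventually_all.2 fun k =>
      eventually_hasDerivAt_along_line (hψ1 (b k)) hΩ (by norm_num) hx v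
  have hwne : ∀ᶠ t : ℝ in nhds 0, ψ (x + t • v) + ε ≠ 0 := by
    have h1 : ContinuousAt (fun t : ℝ => ψ (x + t • v) + ε) 0 :=
      e0.self_of_nhds.continuousAt.add continuousAt_const
    exact h1.eventually_ne (by rw [hline0]; exact hw.ne)
  have hFne : ∀ᶠ t : ℝ in nhds 0, F (x + t • v) ≠ 0 :=
    eF.self_of_nhds.continuousAt.eventually_ne (by rw [hline0]; exact ho.ne')
  have hmax' : IsLocalMax (fun t : ℝ => Real.log (-(ψ (x + t • v) + ε)) +
      Real.log (F (x + t • v)) + β / 2 * ∑ k, dirDeriv (b k) ψ (x + t • v) ^ 2) 0 := by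
    have := hmax
    rw [← hline0] at this
    exact IsLocalMax.comp_continuous (g := fun t : ℝ => x + t • v) (b := 0) this hline
  have hd : ∀ᶠ t : ℝ in nhds 0, HasDerivAt (fun t : ℝ => Real.log (-(ψ (x + t • v) + ε)) +
      Real.log (F (x + t • v)) + β / 2 * ∑ k, dirDeriv (b k) ψ (x + t • v) ^ 2)
      (dirDeriv v ψ (x + t • v) / (ψ (x + t • v) + ε) +
        dirDeriv v F (x + t • v) / F (x + t • v) +
        β * ∑ k, dirDeriv (b k) ψ (x + t • v) * dirDeriv v (dirDeriv (b k) ψ) (x + t • v)) t := by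
    filter_upwards [e0, eF, ek, hwne, hFne] with t h0 hF' hk hw' hFn
    have d1 := ((h0.add_const ε).fun_neg).log (neg_ne_zero.2 hw')
    have d2 := hF'.log hFn
    have d3 := (HasDerivAt.fun_sum fun k (_ : k ∈ Finset.univ) => (hk k).fun_pow 2).const_mul
      (β / 2)
    refine ((d1.add d2).add d3).congr_deriv ?_
    rw [neg_div_neg_eq]
    congr 1
    rw [Finset.mul_sum, Finset.mul_sum]
    refine Finset.sum_congr rfl fun k _ => ?_
    push_cast
    ring
  have hdd : HasDerivAt (fun t : ℝ => dirDeriv v ψ (x + t • v) / (ψ (x + t • v) + ε) +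
        dirDeriv v F (x + t • v) / F (x + t • v) +
        β * ∑ k, dirDeriv (b k) ψ (x + t • v) * dirDeriv v (dirDeriv (b k) ψ) (x + t • v))
      (dirDeriv v (dirDeriv v ψ) x / (ψ x + ε) - (dirDeriv v ψ x / (ψ x + ε)) ^ 2 +
      (dirDeriv v (dirDeriv v F) x / F x - (dirDeriv v F x / F x) ^ 2) +
      β * ∑ k, (dirDeriv v (dirDeriv (b k) ψ) x ^ 2 +
        dirDeriv (b k) ψ x * dirDeriv v (dirDeriv v (dirDeriv (b k) ψ)) x)) 0 := by
    have c0 := hasDerivAt_along_line_zero hψ hΩ (by norm_num) hx v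
    have c1 := hasDerivAt_along_line_zero (hψ1 v) hΩ (by norm_num) hx v
    have cF := hasDerivAt_along_line_zero (hψ2 (b o) (b o)) hΩ (by norm_num) hx v
    have cF1 := hasDerivAt_along_line_zero (hψ3 v (b o) (b o)) hΩ (by norm_num) hx v
    have ck := fun k => hasDerivAt_along_line_zero (hψ1 (b k)) hΩ (by norm_num) hx v
    have ck1 := fun k => hasDerivAt_along_line_zero (hψ2 v (b k)) hΩ (by norm_num) hx v
    have d1 := c1.fun_div (c0.add_const ε) hwne.self_of_nhds
    have d2 := cF1.fun_div cF hFne.self_of_nhds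
    have d3 := (HasDerivAt.fun_sum fun k (_ : k ∈ Finset.univ) =>
      (ck k).fun_mul (ck1 k)).const_mul β
    refine ((d1.add d2).add d3).congr_deriv ?_
    simp only [hline0, ← hF]
    have hw' := hw.ne
    have ho' := ho.ne'
    congr 1
    · congr 1 <;> field_simp
    · congr 1
      refine Finset.sum_congr rfl fun k _ => ?_
      ring
  have key := hmax'.second_deriv_nonpos hd hdd
  simp only [hline0] at key
  exact key

end MaximumPoint

section DifferentiatedEquation

variable {n : ℕ} {Ω : Set (Eu n)} {ψ : Eu n → ℝ}

/-- The equation `log det D²ψ = g(x, ψ, ∇ψ)` differentiated once and twice in the direction `v`,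
at a point where the Hessian is diagonal in the basis `b`. -/
lemma differentiated_equation (hΩ : IsOpen Ω) (hψ : ContDiffOn ℝ 4 ψ Ω)
    (b : OrthonormalBasis (Fin n) ℝ (Eu n)) {x : Eu n} (hx : x ∈ Ω) {l : Fin n → ℝ}
    (hl : ∀ i, 0 < l i)
    (hdiag : ∀ i j, dirDeriv (b i) (dirDeriv (b j) ψ) x = if i = j then l i else 0)
    {g : Eu n × ℝ × Eu n → ℝ} (hg : ContDiffAt ℝ 2 g (x, ψ x, gradient ψ x))
    (heq : ∀ y ∈ Ω, Real.log (Matrix.of fun i j => dirDeriv (b i) (dirDeriv (b j) ψ) y).det =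
      g (y, ψ y, gradient ψ y)) (v : Eu n) :
    ∑ i, dirDeriv v (dirDeriv (b i) (dirDeriv (b i) ψ)) x / l i =
      fderiv ℝ g (x, ψ x, gradient ψ x)
        (v, dirDeriv v ψ x, ∑ k, dirDeriv v (dirDeriv (b k) ψ) x • b k) ∧
    ∑ i, dirDeriv v (dirDeriv v (dirDeriv (b i) (dirDeriv (b i) ψ))) x / l i -
      ∑ i, ∑ j, dirDeriv v (dirDeriv (b i) (dirDeriv (b j) ψ)) x *
        dirDeriv v (dirDeriv (b j) (dirDeriv (b i) ψ)) x / (l i * l j) =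
      fderiv ℝ (fderiv ℝ g) (x, ψ x, gradient ψ x)
        (v, dirDeriv v ψ x, ∑ k, dirDeriv v (dirDeriv (b k) ψ) x • b k)
        (v, dirDeriv v ψ x, ∑ k, dirDeriv v (dirDeriv (b k) ψ) x • b k) +
      fderiv ℝ g (x, ψ x, gradient ψ x)
        (0, dirDeriv v (dirDeriv v ψ) x,
          ∑ k, dirDeriv v (dirDeriv v (dirDeriv (b k) ψ)) x • b k) := by
  have hψ1 : ∀ u, ContDiffOn ℝ 3 (dirDeriv u ψ) Ω := fun u => hψ.dirDeriv hΩ (by norm_num) u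
  have hψ2 : ∀ u u', ContDiffOn ℝ 2 (dirDeriv u (dirDeriv u' ψ)) Ω :=
    fun u u' => (hψ1 u').dirDeriv hΩ (by norm_num) u
  have hψ3 : ∀ u u' u'', ContDiffOn ℝ 1 (dirDeriv u (dirDeriv u' (dirDeriv u'' ψ))) Ω :=
    fun u u' u'' => (hψ2 u' u'').dirDeriv hΩ (by norm_num) u
  have hline0 : x + (0 : ℝ) • v = x := by simp
  obtain ⟨φ, hφ, hφ0, hφ'⟩ := hasDerivAt_log_det
    (A := fun t => Matrix.of fun i j => dirDeriv (b i) (dirDeriv (b j) ψ) (x + t • v))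
    (A' := fun t => Matrix.of fun i j =>
      dirDeriv v (dirDeriv (b i) (dirDeriv (b j) ψ)) (x + t • v))
    (A'' := Matrix.of fun i j => dirDeriv v (dirDeriv v (dirDeriv (b i) (dirDeriv (b j) ψ))) x)
    hl (by
      ext i j
      simp only [Matrix.of_apply, hline0, hdiag, Matrix.diagonal_apply])
    (Filter.eventually_all.2 fun i => Filter.eventually_all.2 fun j =>
      eventually_hasDerivAt_along_line (hψ2 (b i) (b j)) hΩ (by norm_num) hx v)
    (fun i j => hasDerivAt_along_line_zero (hψ3 v (b i) (b j)) hΩ (by norm_num) hx v)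
  simp only [hline0, Matrix.of_apply] at hφ0 hφ'
  have hγ : ∀ᶠ t : ℝ in nhds 0, HasDerivAt
      (fun s : ℝ => (x + s • v, ψ (x + s • v), gradient ψ (x + s • v)))
      (v, dirDeriv v ψ (x + t • v), ∑ k, dirDeriv v (dirDeriv (b k) ψ) (x + t • v) • b k) t := by
    have ek : ∀ᶠ t : ℝ in nhds 0, ∀ k, HasDerivAt (fun s : ℝ => dirDeriv (b k) ψ (x + s • v))
        (dirDeriv v (dirDeriv (b k) ψ) (x + t • v)) t :=
      Filter.eventually_all.2 fun k =>
        eventually_hasDerivAt_along_line (hψ1 (b k)) hΩ (by norm_num) hx v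
    filter_upwards [eventually_hasDerivAt_along_line hψ hΩ (by norm_num) hx v, ek] with t h0 hk
    have h1 : HasDerivAt (fun s : ℝ => x + s • v) v t := by
      simpa using ((hasDerivAt_id t).smul_const v).const_add x
    simp only [gradient_eq_sum b]
    exact h1.prodMk (h0.prodMk (HasDerivAt.fun_sum fun k _ => (hk k).smul_const (b k)))
  have hγ' : HasDerivAt (fun t : ℝ => ((v, dirDeriv v ψ (x + t • v),
      ∑ k, dirDeriv v (dirDeriv (b k) ψ) (x + t • v) • b k) : Eu n × ℝ × Eu n))
      (0, dirDeriv v (dirDeriv v ψ) x, ∑ k, dirDeriv v (dirDeriv v (dirDeriv (b k) ψ)) x • b k)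
      0 :=
    (hasDerivAt_const 0 v).prodMk ((hasDerivAt_along_line_zero (hψ1 v) hΩ (by norm_num) hx v).prodMk
      (HasDerivAt.fun_sum fun k _ => (hasDerivAt_along_line_zero (hψ2 v (b k)) hΩ (by norm_num)
        hx v).smul_const (b k)))
  have hg' := HasFDerivAt.second_deriv_comp (g := g)
    (γ := fun s : ℝ => (x + s • v, ψ (x + s • v), gradient ψ (x + s • v)))
    (x := 0) (by simpa only [hline0] using hg) hγ hγ'
  simp only [hline0] at hg'
  have hsame : (fun s : ℝ => Real.log (Matrix.of fun i j =>
      dirDeriv (b i) (dirDeriv (b j) ψ) (x + s • v)).det) =ᶠ[nhds 0]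
      fun s => g (x + s • v, ψ (x + s • v), gradient ψ (x + s • v)) :=
    (eventually_line_mem hΩ hx v).mono fun t ht => heq _ ht
  have hφg : φ =ᶠ[nhds 0] fun t => fderiv ℝ g (x + t • v, ψ (x + t • v), gradient ψ (x + t • v))
      (v, dirDeriv v ψ (x + t • v), ∑ k, dirDeriv v (dirDeriv (b k) ψ) (x + t • v) • b k) := by
    filter_upwards [hφ, hg'.1, hsame.eventuallyEq_nhds] with t h1 h2 h3
    exact h1.unique (h2.congr_of_eventuallyEq h3)
  constructor
  · rw [← hφ0, hφg.self_of_nhds]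
    simp only [hline0]
  · exact hφ'.unique (hg'.2.congr_of_eventuallyEq hφg)

/-- Pogorelov's estimate at an interior maximum point of the auxiliary function. -/
lemma pogorelov_at_maximum (hΩ : IsOpen Ω) (hψ : ContDiffOn ℝ 4 ψ Ω)
    (b : OrthonormalBasis (Fin n) ℝ (Eu n)) {x : Eu n} (hx : x ∈ Ω) {l : Fin n → ℝ}
    (hl : ∀ i, 0 < l i)
    (hdiag : ∀ i j, dirDeriv (b i) (dirDeriv (b j) ψ) x = if i = j then l i else 0)
    {g : Eu n × ℝ × Eu n → ℝ} (hg : ContDiffAt ℝ 2 g (x, ψ x, gradient ψ x))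
    (heq : ∀ y ∈ Ω, Real.log (Matrix.of fun i j => dirDeriv (b i) (dirDeriv (b j) ψ) y).det =
      g (y, ψ y, gradient ψ y))
    {K₀ K₁ : ℝ} (hK₀ : 0 < K₀) (hK₁ : 0 < K₁)
    (hg1 : ‖fderiv ℝ g (x, ψ x, gradient ψ x)‖ ≤ K₁)
    (hg2 : ‖fderiv ℝ (fderiv ℝ g) (x, ψ x, gradient ψ x)‖ ≤ K₁)
    (hgrad : ‖gradient ψ x‖ ≤ K₀) {ε : ℝ} {o : Fin n}
    (hw : ψ x + ε < 0) (hwK : -(ψ x + ε) ≤ K₀)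
    (hmax : IsLocalMax (fun y => Real.log (-(ψ y + ε)) +
      Real.log (dirDeriv (b o) (dirDeriv (b o) ψ) y) +
      pogorelovWeight K₀ K₁ / 2 * ∑ k, dirDeriv (b k) ψ y ^ 2) x) :
    -(ψ x + ε) * l o ≤ pogorelovBound n K₀ K₁ := by
  have hψ1 : ∀ u, ContDiffOn ℝ 3 (dirDeriv u ψ) Ω := fun u => hψ.dirDeriv hΩ (by norm_num) u
  have hψ3 : ContDiffOn ℝ 3 ψ Ω := hψ.of_le (by norm_num)
  have hdo : dirDeriv (b o) (dirDeriv (b o) ψ) x = l o := by simp [hdiag]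
  set z := (x, ψ x, gradient ψ x) with hz
  have hp : ∀ i, |dirDeriv (b i) ψ x| ≤ K₀ :=
    fun i => (abs_dirDeriv_le_norm_gradient b x i).trans hgrad
  have hTo : ∀ i, dirDeriv (b i) (dirDeriv (b o) (dirDeriv (b o) ψ)) x =
      dirDeriv (b o) (dirDeriv (b o) (dirDeriv (b i) ψ)) x :=
    fun i => dirDeriv_comm_third hψ3 hΩ (b i) (b o) hx
  have hsum : ∀ i, ∑ k, dirDeriv (b i) (dirDeriv (b k) ψ) x • b k = l i • b i := by
    intro i
    simp [hdiag]
  have hdecomp : ∀ i, ((b i, dirDeriv (b i) ψ x, l i • b i) : Eu n × ℝ × Eu n) =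
      (b i, dirDeriv (b i) ψ x, 0) + l i • (0, 0, b i) := by
    intro i
    simp
  refine le_pogorelovBound_of_maximum hK₀ hK₁ o
    (p := fun i => dirDeriv (b i) ψ x)
    (S := fun i => dirDeriv (b i) (dirDeriv (b i) (dirDeriv (b o) (dirDeriv (b o) ψ))) x)
    (q := fun i => fderiv ℝ g z (0, 0, b i))
    (c := fun i => fderiv ℝ g z (b i, dirDeriv (b i) ψ x, 0))
    (T := fun i j => dirDeriv (b o) (dirDeriv (b i) (dirDeriv (b j) ψ)) x)
    (R := fun k i => dirDeriv (b k) (dirDeriv (b i) (dirDeriv (b i) ψ)) x)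
    hl ?_ hw hwK hp ?_ ?_ ?_ ?_ ?_ ?_
  · intro i j
    exact dirDeriv_congr hΩ (dirDeriv_comm_on hψ hΩ (by norm_num) (b i) (b j)) (b o) hx
  · intro i
    refine (ContinuousLinearMap.le_of_opNorm_le _ hg1 _).trans ?_
    simp [Prod.norm_def]
  · intro i
    refine (ContinuousLinearMap.le_of_opNorm_le _ hg1 _).trans ?_
    gcongr
    simp only [Prod.norm_def, OrthonormalBasis.norm_eq_one, norm_zero, Real.norm_eq_abs]
    have := hp i
    exact max_le (by linarith) (max_le (by linarith) (by linarith))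
  · intro i
    have h := (auxiliary_critical_conditions hΩ hψ b hx hw (hdo ▸ hl o) hmax (b i)).1
    rw [hdo, hTo] at h
    rw [← h]
    congr 2
    simp [hdiag]
  · intro i
    have h := (auxiliary_critical_conditions hΩ hψ b hx hw (hdo ▸ hl o) hmax (b i)).2
    rw [hdo, hTo] at h
    refine le_of_eq_of_le ?_ h
    congr 1
    · simp [hdiag]
    · rw [Finset.sum_add_distrib]
      congr 2
      · simp [hdiag]
      · refine Finset.sum_congr rfl fun k _ => ?_
        rw [dirDeriv_comm_third hψ3 hΩ (b k) (b i) hx]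
  · intro k
    have h := (differentiated_equation hΩ hψ b hx hl hdiag hg heq (b k)).1
    rw [h, hsum, hdecomp, map_add, map_smul, smul_eq_mul]
  · have h := (differentiated_equation hΩ hψ b hx hl hdiag hg heq (b o)).2
    have hS : ∀ i, dirDeriv (b i) (dirDeriv (b i) (dirDeriv (b o) (dirDeriv (b o) ψ))) x =
        dirDeriv (b o) (dirDeriv (b o) (dirDeriv (b i) (dirDeriv (b i) ψ))) x :=
      fun i => dirDeriv_comm_fourth hψ hΩ (b i) (b o) hx
    simp only [hS]
    rw [h, hsum, hdo]
    set V : Eu n × ℝ × Eu n := (b o, dirDeriv (b o) ψ x, l o • b o) with hV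
    have hVn : ‖V‖ ≤ 1 + K₀ + l o := by
      simp only [hV, Prod.norm_def, norm_smul, OrthonormalBasis.norm_eq_one, Real.norm_eq_abs,
        abs_of_pos (hl o)]
      have := hp o
      have := hl o
      exact max_le (by linarith) (max_le (by linarith) (by linarith))
    have h1 : |fderiv ℝ (fderiv ℝ g) z V V| ≤ K₁ * (1 + K₀ + l o) ^ 2 := by
      have h2 := (fderiv ℝ (fderiv ℝ g) z).le_opNorm₂ V V
      rw [Real.norm_eq_abs] at h2
      refine h2.trans ?_
      rw [mul_assoc, ← sq]
      gcongr
    have hsplit : ((0, l o, ∑ k, dirDeriv (b o) (dirDeriv (b o) (dirDeriv (b k) ψ)) x • b k) :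
        Eu n × ℝ × Eu n) = (0, l o, 0) +
        ∑ k, dirDeriv (b o) (dirDeriv (b o) (dirDeriv (b k) ψ)) x • (0, 0, b k) := by
      have h (c : Fin n → ℝ) : ∑ k, c k • ((0, 0, b k) : Eu n × ℝ × Eu n) =
          (0, 0, ∑ k, c k • b k) := by
        refine Prod.ext ?_ (Prod.ext ?_ ?_) <;> simp [Prod.fst_sum, Prod.snd_sum]
      rw [h]
      simp
    have h3 : |fderiv ℝ g z (0, l o, 0)| ≤ K₁ * l o := by
      refine (ContinuousLinearMap.le_of_opNorm_le _ hg1 _).trans ?_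
      simp [Prod.norm_def, abs_of_pos (hl o), (hl o).le]
    rw [hsplit, map_add, map_sum]
    simp only [map_smul, smul_eq_mul]
    have h4 : ∑ k, fderiv ℝ g z (0, 0, b k) * dirDeriv (b o) (dirDeriv (b o) (dirDeriv (b k) ψ)) x =
        ∑ k, dirDeriv (b o) (dirDeriv (b o) (dirDeriv (b k) ψ)) x * fderiv ℝ g z (0, 0, b k) :=
      Finset.sum_congr rfl fun k _ => mul_comm _ _
    rw [h4]
    have h5 := neg_le_of_abs_le h1
    have h6 := neg_le_of_abs_le h3
    linarith

end DifferentiatedEquation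

section SymmetricBilinear

variable {n : ℕ} {B : Eu n →L[ℝ] Eu n →L[ℝ] ℝ}

lemma exists_orthonormalBasis_diagonal (hB : ∀ v w, B v w = B w v) :
    ∃ (b : OrthonormalBasis (Fin n) ℝ (Eu n)) (l : Fin n → ℝ),
      ∀ i j, B (b i) (b j) = if i = j then l i else 0 := by
  let T : Eu n →ₗ[ℝ] Eu n :=
    { toFun := fun v => (InnerProductSpace.toDual ℝ (Eu n)).symm (B v)
      map_add' := by simp
      map_smul' := by simp }
  have hT (v w : Eu n) : inner ℝ (T v) w = B v w := by simp [T]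
  have hsymm : T.IsSymmetric := fun v w => by
    rw [hT, real_inner_comm, hT, hB]
  refine ⟨hsymm.eigenvectorBasis finrank_euclideanSpace_fin,
    hsymm.eigenvalues finrank_euclideanSpace_fin, fun i j => ?_⟩
  rw [← hT, hsymm.apply_eigenvectorBasis, inner_smul_left,
    orthonormal_iff_ite.1 (hsymm.eigenvectorBasis finrank_euclideanSpace_fin).orthonormal]
  simp

lemma apply_self_le_of_diagonal {b : OrthonormalBasis (Fin n) ℝ (Eu n)} {l : Fin n → ℝ}
    (hdiag : ∀ i j, B (b i) (b j) = if i = j then l i else 0) {c : ℝ} (hc : ∀ i, l i ≤ c)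
    (v : Eu n) : B v v ≤ c * ‖v‖ ^ 2 := by
  have hv : B v v = ∑ i, inner ℝ (b i) v ^ 2 * l i := by
    conv_lhs => rw [← b.sum_repr' v]
    simp only [map_sum, map_smul, sum_apply, smul_apply,
      hdiag, smul_eq_mul]
    refine Finset.sum_congr rfl fun i _ => ?_
    simp [sq, mul_assoc]
  have hn : ‖v‖ ^ 2 = ∑ i, inner ℝ (b i) v ^ 2 := by
    rw [← b.sum_sq_norm_inner_right v]
    simp
  rw [hv, hn, Finset.mul_sum]
  refine Finset.sum_le_sum fun i _ => ?_
  rw [mul_comm]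
  exact mul_le_mul_of_nonneg_right (hc i) (sq_nonneg _)

lemma opNorm_le_of_apply_self_le (hB : ∀ v w, B v w = B w v) (hpos : ∀ v, 0 ≤ B v v) {M : ℝ}
    (hM : ∀ v, ‖v‖ = 1 → B v v ≤ M) (hM0 : 0 ≤ M) : ‖B‖ ≤ M := by
  have hM' (v : Eu n) : B v v ≤ M * ‖v‖ ^ 2 := by
    rcases eq_or_ne v 0 with rfl | hv
    · simp
    have hv' : ‖v‖ ≠ 0 := norm_ne_zero_iff.2 hv
    have h := hM (‖v‖⁻¹ • v) (by rw [norm_smul, norm_inv, norm_norm, inv_mul_cancel₀ hv'])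
    simp only [map_smul, smul_apply, smul_eq_mul] at h
    have h2 := mul_le_mul_of_nonneg_right h (sq_nonneg ‖v‖)
    have h3 : ‖v‖⁻¹ * (‖v‖⁻¹ * B v v) * ‖v‖ ^ 2 = B v v := by field_simp
    rwa [h3] at h2
  have key (v w : Eu n) (hv : ‖v‖ = 1) (hw : ‖w‖ = 1) : ‖B v w‖ ≤ M := by
    have h1 := hM' (v + w)
    have h2 := hM' (v - w)
    have h3 := hpos (v + w)
    have h4 := hpos (v - w)
    have h5 := parallelogram_law_with_norm ℝ v w
    simp only [map_add, map_sub, add_apply, sub_apply,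
      hB w v] at h1 h2 h3 h4
    rw [hv, hw] at h5
    rw [Real.norm_eq_abs, abs_le]
    have h6 : ‖v + w‖ ^ 2 + ‖v - w‖ ^ 2 = 4 := by linarith [h5, sq ‖v + w‖, sq ‖v - w‖]
    have h7 : M * ‖v + w‖ ^ 2 + M * ‖v - w‖ ^ 2 = 4 * M := by rw [← mul_add, h6]; ring
    constructor <;> linarith
  refine ContinuousLinearMap.opNorm_le_of_unit_norm hM0 fun v hv => ?_
  exact ContinuousLinearMap.opNorm_le_of_unit_norm hM0 fun w hw => key v w hv hw

lemma det_toMatrix_orthonormalBasis (b c : OrthonormalBasis (Fin n) ℝ (Eu n)) :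
    (Matrix.of fun i j => B (b i) (b j)).det = (Matrix.of fun i j => B (c i) (c j)).det := by
  let β : LinearMap.BilinForm ℝ (Eu n) :=
    LinearMap.mk₂ ℝ (fun v w => B v w) (by simp) (by simp) (by simp) (by simp)
  have h (d : OrthonormalBasis (Fin n) ℝ (Eu n)) :
      (Matrix.of fun i j => B (d i) (d j)) = LinearMap.BilinForm.toMatrix d.toBasis β := by
    ext i j
    simp [LinearMap.BilinForm.toMatrix_apply, β]
  rw [h, h, ← LinearMap.BilinForm.toMatrix_mul_basis_toMatrix b.toBasis c.toBasis β,
    Matrix.det_mul, Matrix.det_mul, Matrix.det_transpose]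
  have h2 : (b.toBasis.toMatrix c.toBasis).det * (b.toBasis.toMatrix c.toBasis).det = 1 := by
    have := b.det_to_matrix_orthonormalBasis_real c
    rw [Module.Basis.det_apply] at this
    simp only [OrthonormalBasis.coe_toBasis] at this ⊢
    rcases this with h | h <;> rw [h] <;> norm_num
  rw [mul_right_comm, h2, one_mul]

end SymmetricBilinear

section Hessian

variable {E : Type*} [NormedAddCommGroup E] [NormedSpace ℝ E] {Ω : Set E} {f : E → ℝ}

lemma ConvexOn.fderiv_fderiv_apply_self_nonneg (hconv : ConvexOn ℝ Ω f) (hΩ : IsOpen Ω)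
    (hf : ContDiffOn ℝ 2 f Ω) {x : E} (hx : x ∈ Ω) (v : E) :
    0 ≤ fderiv ℝ (fderiv ℝ f) x v v := by
  have hline (v : E) : ∀ᶠ t : ℝ in nhds 0, HasDerivAt (fun s : ℝ => f (x + s • v))
      (dirDeriv v f (x + t • v)) t := by
    filter_upwards [eventually_line_mem hΩ hx v] with t ht
    exact hasDerivAt_along_line (hf.differentiableAt_of_isOpen hΩ (by norm_num) ht)
  have hline2 (v : E) : HasDerivAt (fun s : ℝ => dirDeriv v f (x + s • v))
      (fderiv ℝ (fderiv ℝ f) x v v) 0 := by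
    have h := hasDerivAt_along_line (f := dirDeriv v f) (x := x) (v := v) (t := 0)
      (by
        rw [zero_smul, add_zero]
        exact (hf.dirDeriv (m := 1) hΩ (by norm_num) v).differentiableAt_of_isOpen hΩ
          (by norm_num) hx)
    rw [zero_smul, add_zero, dirDeriv_dirDeriv (hf.contDiffAt (hΩ.mem_nhds hx))] at h
    exact h
  have hmax : IsLocalMax (fun t : ℝ => -(f (x + t • v) + f (x + t • -v))) 0 := by
    filter_upwards [eventually_line_mem hΩ hx v, eventually_line_mem hΩ hx (-v)] with t h1 h2
    have h3 := hconv.2 h1 h2 (by norm_num : (0:ℝ) ≤ 1 / 2) (by norm_num : (0:ℝ) ≤ 1 / 2)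
      (by norm_num)
    have h4 : (1 / 2 : ℝ) • (x + t • v) + (1 / 2 : ℝ) • (x + t • -v) = x := by module
    rw [h4] at h3
    simp only [smul_eq_mul, zero_smul, add_zero] at h3 ⊢
    linarith
  have h := (hmax.second_deriv_nonpos
    (((hline v).and (hline (-v))).mono fun t ht => (ht.1.add ht.2).neg)
    ((hline2 v).add (hline2 (-v))).neg).2
  simp only [map_neg, neg_apply, neg_neg] at h
  linarith

end Hessian

lemma norm_fderiv_le_of_iteratedFDerivWithin {F : Type*} [NormedAddCommGroup F] [NormedSpace ℝ F]
    {S : Set F} {g : F → ℝ} {z : F} {K : ℝ} (hS : UniqueDiffOn ℝ S) (hz : z ∈ S)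
    (hg : ContDiffAt ℝ 2 g z) (h : ∀ k ≤ 2, ‖iteratedFDerivWithin ℝ k g S z‖ ≤ K) :
    ‖fderiv ℝ g z‖ ≤ K ∧ ‖fderiv ℝ (fderiv ℝ g) z‖ ≤ K := by
  constructor
  · have h1 := h 1 (by norm_num)
    rwa [iteratedFDerivWithin_eq_iteratedFDeriv hS (hg.of_le (by norm_num)) hz,
      norm_iteratedFDeriv_one] at h1
  · have h2 := h 2 le_rfl
    rwa [iteratedFDerivWithin_eq_iteratedFDeriv hS (by exact_mod_cast hg) hz,
      ← norm_iteratedFDeriv_fderiv, norm_iteratedFDeriv_one] at h2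

lemma isCompact_closure_inter_sublevel {E : Type*} [NormedAddCommGroup E] [ProperSpace E]
    {Ω : Set E} {f : E → ℝ} (hb : Bornology.IsBounded Ω) (hf : ContinuousOn f (closure Ω))
    {c : ℝ} : IsCompact (closure Ω ∩ f ⁻¹' Set.Iic c) :=
  Metric.isCompact_of_isClosed_isBounded
    (hf.preimage_isClosed_of_isClosed isClosed_closure isClosed_Iic)
    (hb.closure.subset Set.inter_subset_left)

lemma closure_inter_sublevel_subset {E : Type*} [TopologicalSpace E] {Ω : Set E} {f : E → ℝ}
    (hΩ : IsOpen Ω) (h0 : ∀ x ∈ frontier Ω, f x = 0) {c : ℝ} (hc : c < 0) :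
    closure Ω ∩ f ⁻¹' Set.Iic c ⊆ Ω := by
  rintro y ⟨hy, hyc⟩
  by_contra hyΩ
  have h := h0 y (by rw [hΩ.frontier_eq]; exact ⟨hy, hyΩ⟩)
  rw [Set.mem_preimage, h] at hyc
  exact absurd hc (not_lt.2 hyc)

lemma pogorelovBound_pos (n : ℕ) {K₀ K₁ : ℝ} (hK₀ : 0 < K₀) (hK₁ : 0 < K₁) :
    0 < pogorelovBound n K₀ K₁ := by
  have := pogorelovWeight_pos (K₀ := K₀) hK₁
  unfold pogorelovBound
  positivity

section Pogorelov

variable {n : ℕ} {Ω : Set (Eu n)} {ψ : Eu n → ℝ}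

lemma norm_gradient (y : Eu n) : ‖gradient ψ y‖ = ‖fderiv ℝ ψ y‖ := by
  simp [gradient]

lemma det_dirDeriv_eq_det_pd2 (hΩ : IsOpen Ω) (hψ : ContDiffOn ℝ 2 ψ Ω)
    (b : OrthonormalBasis (Fin n) ℝ (Eu n)) {y : Eu n} (hy : y ∈ Ω) :
    (Matrix.of fun i j => dirDeriv (b i) (dirDeriv (b j) ψ) y).det =
      (Matrix.of fun i j => pd2 ψ i j y).det := by
  have hat := hψ.contDiffAt (hΩ.mem_nhds hy)
  have h1 : (Matrix.of fun i j => pd2 ψ i j y) = Matrix.of fun i j =>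
      fderiv ℝ (fderiv ℝ ψ) y (EuclideanSpace.basisFun (Fin n) ℝ i)
        (EuclideanSpace.basisFun (Fin n) ℝ j) := by
    ext i j
    rw [Matrix.of_apply, Matrix.of_apply, ← dirDeriv_dirDeriv hat]
    simp only [EuclideanSpace.basisFun_apply]
    rfl
  simp only [dirDeriv_dirDeriv hat]
  rw [h1, det_toMatrix_orthonormalBasis]

lemma pogorelov_on_sublevel (hn : 0 < n) (hΩ : IsOpen Ω) (hbdd : Bornology.IsBounded Ω)
    (hψ : ContDiffOn ℝ 4 ψ Ω) (hcont : ContinuousOn ψ (closure Ω)) (hconv : ConvexOn ℝ Ω ψ)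
    (h0 : ∀ x ∈ frontier Ω, ψ x = 0) {g : Eu n × ℝ × Eu n → ℝ}
    (hdet : ∀ y ∈ Ω, 0 < (Matrix.of fun i j => pd2 ψ i j y).det)
    (hg : ∀ y ∈ Ω, ContDiffAt ℝ 2 g (y, ψ y, gradient ψ y))
    (heq : ∀ y ∈ Ω, Real.log (Matrix.of fun i j => pd2 ψ i j y).det = g (y, ψ y, gradient ψ y))
    {K₀ K₁ : ℝ} (hK₀ : 0 < K₀) (hK₁ : 0 < K₁)
    (hg1 : ∀ y ∈ Ω, ‖fderiv ℝ g (y, ψ y, gradient ψ y)‖ ≤ K₁)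
    (hg2 : ∀ y ∈ Ω, ‖fderiv ℝ (fderiv ℝ g) (y, ψ y, gradient ψ y)‖ ≤ K₁)
    (hbound : ∀ y ∈ Ω, |ψ y| + ‖gradient ψ y‖ ≤ K₀) {ε : ℝ} (hε : 0 < ε) {x : Eu n} (hx : x ∈ Ω)
    (hxε : ψ x < -ε) {ξ : Eu n} (hξ : ‖ξ‖ = 1) :
    -(ψ x + ε) * fderiv ℝ (fderiv ℝ ψ) x ξ ξ ≤
      pogorelovBound n K₀ K₁ * Real.exp (pogorelovWeight K₀ K₁ / 2 * K₀ ^ 2) := by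
  have hβ := pogorelovWeight_pos (K₀ := K₀) hK₁
  have hP := pogorelovBound_pos n hK₀ hK₁
  set β := pogorelovWeight K₀ K₁ with hβdef
  have hψ2 : ContDiffOn ℝ 2 ψ Ω := hψ.of_le (by norm_num)
  have hat (y : Eu n) (hy : y ∈ Ω) : ContDiffAt ℝ 2 ψ y := hψ2.contDiffAt (hΩ.mem_nhds hy)
  have hgrad (y : Eu n) (hy : y ∈ Ω) : ‖gradient ψ y‖ ≤ K₀ := by
    linarith [hbound y hy, abs_nonneg (ψ y)]
  have hBnn (y : Eu n) (hy : y ∈ Ω) (v : Eu n) : 0 ≤ fderiv ℝ (fderiv ℝ ψ) y v v :=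
    hconv.fderiv_fderiv_apply_self_nonneg hΩ hψ2 hy v
  have hD1 : ContDiffOn ℝ 3 (fderiv ℝ ψ) Ω := hψ.fderiv_of_isOpen hΩ (by norm_num)
  have hD2 : ContDiffOn ℝ 2 (fderiv ℝ (fderiv ℝ ψ)) Ω := hD1.fderiv_of_isOpen hΩ (by norm_num)
  rcases (hBnn x hx ξ).eq_or_lt with hzero | hBpos
  · rw [← hzero, mul_zero]
    positivity
  let F : Eu n × Eu n → ℝ := fun p => -(ψ p.1 + ε) * fderiv ℝ (fderiv ℝ ψ) p.1 p.2 p.2 *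
    Real.exp (β / 2 * ‖fderiv ℝ ψ p.1‖ ^ 2)
  set K := closure Ω ∩ ψ ⁻¹' Set.Iic (-ε) with hKdef
  have hKΩ : K ⊆ Ω := closure_inter_sublevel_subset hΩ h0 (neg_lt_zero.2 hε)
  have hKc : IsCompact (K ×ˢ Metric.sphere (0 : Eu n) 1) :=
    (isCompact_closure_inter_sublevel hbdd hcont).prod (isCompact_sphere 0 1)
  have hF : ContinuousOn F (K ×ˢ Metric.sphere (0 : Eu n) 1) := by
    have hfst : Set.MapsTo (Prod.fst : Eu n × Eu n → Eu n) (K ×ˢ Metric.sphere (0 : Eu n) 1) Ω :=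
      fun p hp => hKΩ hp.1
    have c0 := hψ.continuousOn.comp continuousOn_fst hfst
    have c1 := hD1.continuousOn.comp continuousOn_fst hfst
    have c2 := hD2.continuousOn.comp continuousOn_fst hfst
    exact ((c0.add continuousOn_const).neg.mul
      ((c2.clm_apply continuousOn_snd).clm_apply continuousOn_snd)).mul
      (Real.continuous_exp.comp_continuousOn (continuousOn_const.mul (c1.norm.pow 2)))
  have hmemK (y v : Eu n) (hy : y ∈ Ω) (hyε : ψ y ≤ -ε) (hv : ‖v‖ = 1) :
      (y, v) ∈ K ×ˢ Metric.sphere (0 : Eu n) 1 :=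
    ⟨⟨subset_closure hy, hyε⟩, by simpa using hv⟩
  obtain ⟨⟨x₀, ξ₀⟩, hx₀, hmax⟩ := hKc.exists_isMaxOn ⟨(x, ξ), hmemK x ξ hx hxε.le hξ⟩ hF
  have hx₀Ω : x₀ ∈ Ω := hKΩ hx₀.1
  have hξ₀ : ‖ξ₀‖ = 1 := by simpa using hx₀.2
  have hxF : -(ψ x + ε) * fderiv ℝ (fderiv ℝ ψ) x ξ ξ ≤ F (x, ξ) :=
    le_mul_of_one_le_right (mul_nonneg (by linarith) hBpos.le)
      (Real.one_le_exp (by positivity))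
  have hFpos : 0 < F (x₀, ξ₀) :=
    ((mul_pos (by linarith) hBpos).trans_le hxF).trans_le
      (hmax (hmemK x ξ hx hxε.le hξ))
  have hw : ψ x₀ + ε < 0 := by
    have h1 : ψ x₀ ≤ -ε := hx₀.1.2
    refine lt_of_le_of_ne (by linarith) fun h => ?_
    simp only [F, h, neg_zero, zero_mul, lt_irrefl] at hFpos
  obtain ⟨b, l, hbl⟩ := exists_orthonormalBasis_diagonal
    (B := fderiv ℝ (fderiv ℝ ψ) x₀) fun v w => ((hat x₀ hx₀Ω).isSymmSndFDerivAt (by simp)).eq v w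
  have hdiag (i j : Fin n) : dirDeriv (b i) (dirDeriv (b j) ψ) x₀ = if i = j then l i else 0 := by
    rw [dirDeriv_dirDeriv (hat x₀ hx₀Ω), hbl]
  have hl : ∀ i, 0 < l i := by
    have hprod : (∏ i, l i) ≠ 0 := by
      have h1 := hdet x₀ hx₀Ω
      rw [← det_dirDeriv_eq_det_pd2 hΩ hψ2 b hx₀Ω] at h1
      have h2 : (Matrix.of fun i j => dirDeriv (b i) (dirDeriv (b j) ψ) x₀) =
          Matrix.diagonal l := by
        ext i j
        rw [Matrix.of_apply, hdiag, Matrix.diagonal_apply]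
      rw [h2, Matrix.det_diagonal] at h1
      exact h1.ne'
    intro i
    have h3 := hBnn x₀ hx₀Ω (b i)
    rw [hbl, if_pos rfl] at h3
    exact h3.lt_of_ne' (Finset.prod_ne_zero_iff.1 hprod i (Finset.mem_univ i))
  have : Nonempty (Fin n) := ⟨⟨0, hn⟩⟩
  obtain ⟨o, ho⟩ := Finite.exists_max l
  have hlo : fderiv ℝ (fderiv ℝ ψ) x₀ (b o) (b o) = l o := by rw [hbl, if_pos rfl]
  have hF₀ : F (x₀, ξ₀) ≤ F (x₀, b o) := by
    have h1 := apply_self_le_of_diagonal hbl ho ξ₀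
    rw [hξ₀, one_pow, mul_one, ← hlo] at h1
    exact mul_le_mul_of_nonneg_right (mul_le_mul_of_nonneg_left h1 (by linarith))
      (Real.exp_pos _).le
  have hlogF (y : Eu n) (hy : y ∈ Ω) (hyε : ψ y < -ε)
      (hyB : 0 < fderiv ℝ (fderiv ℝ ψ) y (b o) (b o)) :
      Real.log (-(ψ y + ε)) + Real.log (dirDeriv (b o) (dirDeriv (b o) ψ) y) +
        β / 2 * ∑ k, dirDeriv (b k) ψ y ^ 2 = Real.log (F (y, b o)) := by
    have h1 : -(ψ y + ε) ≠ 0 := by linarith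
    rw [Real.log_mul (mul_ne_zero h1 hyB.ne') (Real.exp_ne_zero _), Real.log_mul h1 hyB.ne',
      Real.log_exp, dirDeriv_dirDeriv (hat y hy), ← norm_gradient, norm_gradient_sq b y]
  have hlocal : IsLocalMax (fun y => Real.log (-(ψ y + ε)) +
      Real.log (dirDeriv (b o) (dirDeriv (b o) ψ) y) + β / 2 * ∑ k, dirDeriv (b k) ψ y ^ 2) x₀ := by
    have hnhds := hΩ.mem_nhds hx₀Ω
    have e1 : ∀ᶠ y in nhds x₀, ψ y < -ε :=
      (hψ.continuousOn.continuousAt hnhds).eventually_lt continuousAt_const (by linarith)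
    have e2 : ∀ᶠ y in nhds x₀, 0 < fderiv ℝ (fderiv ℝ ψ) y (b o) (b o) :=
      continuousAt_const.eventually_lt (((hD2.continuousOn.continuousAt hnhds).clm_apply
        continuousAt_const).clm_apply continuousAt_const) (by rw [hlo]; exact hl o)
    filter_upwards [hnhds, e1, e2] with y hy hyε hyB
    rw [hlogF y hy hyε hyB, hlogF x₀ hx₀Ω (by linarith) (by rw [hlo]; exact hl o)]
    refine Real.log_le_log ?_ ((hmax (hmemK y (b o) hy hyε.le (b.norm_eq_one o))).trans hF₀)
    exact mul_pos (mul_pos (by linarith) hyB) (Real.exp_pos _)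
  have hwK : -(ψ x₀ + ε) ≤ K₀ := by
    linarith [hbound x₀ hx₀Ω, neg_abs_le (ψ x₀), norm_nonneg (gradient ψ x₀)]
  have hfinal := pogorelov_at_maximum hΩ hψ b hx₀Ω hl hdiag (hg x₀ hx₀Ω)
    (fun y hy => by rw [det_dirDeriv_eq_det_pd2 hΩ hψ2 b hy, heq y hy]) hK₀ hK₁ (hg1 x₀ hx₀Ω)
    (hg2 x₀ hx₀Ω) (hgrad x₀ hx₀Ω) hw hwK hlocal
  calc -(ψ x + ε) * fderiv ℝ (fderiv ℝ ψ) x ξ ξ ≤ F (x₀, ξ₀) :=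
        hxF.trans (hmax (hmemK x ξ hx hxε.le hξ))
    _ ≤ F (x₀, b o) := hF₀
    _ = -(ψ x₀ + ε) * l o * Real.exp (β / 2 * ‖fderiv ℝ ψ x₀‖ ^ 2) := by rw [← hlo]
    _ ≤ pogorelovBound n K₀ K₁ * Real.exp (β / 2 * K₀ ^ 2) := by
        have := hgrad x₀ hx₀Ω
        rw [norm_gradient] at this
        gcongr

end Pogorelov

theorem stmt2 (n : ℕ) (hn : 2 ≤ n) (K₀ K₁ : ℝ) (hK₀ : 0 < K₀) (hK₁ : 0 < K₁) :
    ∃ C : ℝ, 0 < C ∧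
      ∀ (Ω : Set (Eu n)), IsOpen Ω → Bornology.IsBounded Ω → Convex ℝ Ω →
      ∀ ψ : Eu n → ℝ,
        -- ψ ∈ C⁴(Ω) ∩ C⁰(Ω̄), convex, ψ = 0 on ∂Ω
        ContDiffOn ℝ 4 ψ Ω → ContinuousOn ψ (closure Ω) →
        ConvexOn ℝ (closure Ω) ψ →
        (∀ x ∈ frontier Ω, ψ x = 0) →
        ∀ h : Eu n × ℝ × Eu n → ℝ,
          -- h is a positive C² function on Ω × ℝ × ℝⁿ
          ContDiffOn ℝ 2 h (Ω ×ˢ (Set.univ : Set (ℝ × Eu n))) →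
          (∀ z ∈ Ω ×ˢ (Set.univ : Set (ℝ × Eu n)), 0 < h z) →
          -- det D²ψ = h(x, ψ, Dψ) in Ω
          (∀ x ∈ Ω, (Matrix.of fun i j => pd2 ψ i j x).det = h (x, ψ x, gradient ψ x)) →
          -- sup_Ω(|ψ| + |Dψ|) ≤ K₀
          (∀ x ∈ Ω, |ψ x| + ‖gradient ψ x‖ ≤ K₀) →
          -- ‖log h‖_{C²(Ω × [-K₀,K₀] × B̄_{K₀})} ≤ K₁
          (∀ k ≤ 2, ∀ z ∈ Ω ×ˢ (Set.Icc (-K₀) K₀ ×ˢ Metric.closedBall (0 : Eu n) K₀),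
            ‖iteratedFDerivWithin ℝ k (fun p => Real.log (h p))
              (Ω ×ˢ (Set.Icc (-K₀) K₀ ×ˢ Metric.closedBall (0 : Eu n) K₀)) z‖ ≤ K₁) →
          -- conclusion: (-ψ(x))·‖D²ψ(x)‖ ≤ C in Ω
          ∀ x ∈ Ω, (-ψ x) * ‖fderiv ℝ (fderiv ℝ ψ) x‖ ≤ C := by
  have hP := pogorelovBound_pos n hK₀ hK₁
  set M := pogorelovBound n K₀ K₁ * Real.exp (pogorelovWeight K₀ K₁ / 2 * K₀ ^ 2) with hM
  have hMpos : 0 < M := by positivity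
  refine ⟨2 * M, by positivity, ?_⟩
  intro Ω hΩ hbdd hΩconv ψ hψ hcont hconv h0 h hh hhpos hdet hbound hC2 x hx
  rcases le_or_gt 0 (ψ x) with hx0 | hx0
  · have := mul_nonneg hx0 (norm_nonneg (fderiv ℝ (fderiv ℝ ψ) x))
    linarith
  set S := Ω ×ˢ (Set.Icc (-K₀) K₀ ×ˢ Metric.closedBall (0 : Eu n) K₀) with hS
  have hconvΩ : ConvexOn ℝ Ω ψ := hconv.subset subset_closure hΩconv
  have hSdiff : UniqueDiffOn ℝ S := by
    refine hΩ.uniqueDiffOn.prod ((uniqueDiffOn_Icc (by linarith)).prod ?_)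
    refine uniqueDiffOn_convex (convex_closedBall 0 K₀) ?_
    exact ⟨0, Metric.ball_subset_interior_closedBall (Metric.mem_ball_self hK₀)⟩
  have hzS (y : Eu n) (hy : y ∈ Ω) : (y, ψ y, gradient ψ y) ∈ S := by
    have h1 := hbound y hy
    refine ⟨hy, abs_le.1 (by linarith [norm_nonneg (gradient ψ y)]), ?_⟩
    rw [mem_closedBall_zero_iff]
    linarith [abs_nonneg (ψ y)]
  have hg (y : Eu n) (hy : y ∈ Ω) :
      ContDiffAt ℝ 2 (fun p => Real.log (h p)) (y, ψ y, gradient ψ y) := by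
    have hmem : (y, ψ y, gradient ψ y) ∈ Ω ×ˢ (Set.univ : Set (ℝ × Eu n)) := ⟨hy, trivial⟩
    exact (hh.contDiffAt ((hΩ.prod isOpen_univ).mem_nhds hmem)).log (hhpos _ hmem).ne'
  have hgK (y : Eu n) (hy : y ∈ Ω) := norm_fderiv_le_of_iteratedFDerivWithin hSdiff (hzS y hy)
    (hg y hy) fun k hk => hC2 k hk _ (hzS y hy)
  have hψ2 : ContDiffOn ℝ 2 ψ Ω := hψ.of_le (by norm_num)
  have key (ξ : Eu n) (hξ : ‖ξ‖ = 1) :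
      -(ψ x + -ψ x / 2) * fderiv ℝ (fderiv ℝ ψ) x ξ ξ ≤ M :=
    pogorelov_on_sublevel (by omega) hΩ hbdd hψ hcont hconvΩ h0
      (fun y hy => by rw [hdet y hy]; exact hhpos _ ⟨hy, trivial⟩) hg
      (fun y hy => by rw [hdet y hy]) hK₀ hK₁ (fun y hy => (hgK y hy).1)
      (fun y hy => (hgK y hy).2) hbound (by linarith) hx (by linarith) hξ
  have hnorm : ‖fderiv ℝ (fderiv ℝ ψ) x‖ ≤ 2 * M / (-ψ x) := by
    refine opNorm_le_of_apply_self_le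
      (fun v w => ((hψ2.contDiffAt (hΩ.mem_nhds hx)).isSymmSndFDerivAt (by simp)).eq v w)
      (hconvΩ.fderiv_fderiv_apply_self_nonneg hΩ hψ2 hx) (fun ξ hξ => ?_)
      (div_nonneg (by positivity) (by linarith))
    rw [le_div_iff₀ (by linarith)]
    linarith [key ξ hξ]
  rw [le_div_iff₀ (by linarith)] at hnorm
  linarith
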